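/- Let ρ_AB be a positive semidefinite matrix and γ_AB a positive definite matrix, both indexed by (A×B)×(A×B) with A of size d_A and B of size d_B. Then H(Tr_B ρ_AB, Tr_B γ_AB) ≤ H(ρ_AB, γ_AB), i.e., relative entropy is monotone under the partial trace. -/

import Mathlib

open Matrix MeasureTheory
open scoped Kronecker ComplexOrder

/-- Matrix logarithm via spectral decomposition of a Hermitian matrix, with the
convention `log 0 = 0` on the kernel (i.e. `log` is taken on the support). -/
noncomputable def matLog {n : Type*} [Fintype n] [DecidableEq n] (A : Matrix n n ℂ) :
    Matrix n n ℂ := by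
  classical
  exact if hA : A.IsHermitian then
    (hA.eigenvectorUnitary : Matrix n n ℂ) *
      Matrix.diagonal (fun i => (Real.log (hA.eigenvalues i) : ℂ)) *
      ((hA.eigenvectorUnitary : Matrix n n ℂ))ᴴ
  else 0

/-- Quantum relative entropy `H(P,Q) = Tr[P (log P - log Q)]`. -/
noncomputable def relEnt {n : Type*} [Fintype n] [DecidableEq n] (P Q : Matrix n n ℂ) : ℝ :=
  ((P * (matLog P - matLog Q)).trace).re

/-- Von Neumann entropy `S(ρ) = -Tr[ρ log ρ]`. -/
noncomputable def vNEnt {n : Type*} [Fintype n] [DecidableEq n] (ρ : Matrix n n ℂ) : ℝ :=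
  -((ρ * matLog ρ).trace).re

/-- Partial trace over the second tensor factor. -/
noncomputable def ptraceB {A B : Type*} [Fintype B] (M : Matrix (A × B) (A × B) ℂ) :
    Matrix A A ℂ :=
  Matrix.of fun a a' => ∑ b : B, M (a, b) (a', b)

section Scalar

/-- Antiderivative computation behind the integral representation of `x log x - x log y`. -/
theorem hasDerivAt_mul_sub_mul_log {x y s : ℝ} (h : s * y + (1 - s) * x ≠ 0) :
    HasDerivAt (fun s => s * (y - x) - x * Real.log (s * y + (1 - s) * x))
      (s * ((x - y) ^ 2 / (s * y + (1 - s) * x))) s := by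
  have hD : HasDerivAt (fun s : ℝ => s * y + (1 - s) * x) (1 * y + (0 - 1) * x) s :=
    ((hasDerivAt_id s).mul_const y).add
      (((hasDerivAt_const s (1 : ℝ)).sub (hasDerivAt_id s)).mul_const x)
  refine (((hasDerivAt_id s).mul_const (y - x)).sub ((hD.log h).const_mul x)).congr_deriv ?_
  generalize hd : s * y + (1 - s) * x = d at h
  field_simp
  rw [← hd]
  ring

theorem convexCombo_pos {x y s : ℝ} (hx : 0 ≤ x) (hy : 0 < y) (hs : s ∈ Set.Ioc (0 : ℝ) 1) :
    0 < s * y + (1 - s) * x :=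
  add_pos_of_pos_of_nonneg (mul_pos hs.1 hy) (mul_nonneg (sub_nonneg.2 hs.2) hx)

theorem intervalIntegrable_and_integral_log {x y : ℝ} (hx : 0 ≤ x) (hy : 0 < y) :
    IntervalIntegrable (fun s => s * ((x - y) ^ 2 / (s * y + (1 - s) * x))) volume 0 1 ∧
      ∫ s in (0 : ℝ)..1, s * ((x - y) ^ 2 / (s * y + (1 - s) * x)) =
        x * Real.log x - x * Real.log y - x + y := by
  rcases hx.eq_or_lt with rfl | hx
  · have h : Set.EqOn (fun _ : ℝ => y) (fun s => s * ((0 - y) ^ 2 / (s * y + (1 - s) * 0)))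
        (Set.uIoc (0 : ℝ) 1) := by
      intro s hs
      rw [Set.uIoc_of_le zero_le_one] at hs
      have := hs.1.ne'
      simp only
      field_simp
      ring
    refine ⟨(intervalIntegrable_const (c := y)).congr h, ?_⟩
    rw [← intervalIntegral.integral_congr_ae (ae_of_all _ fun s hs => h hs)]
    simp
  · have hpos : ∀ s ∈ Set.uIcc (0 : ℝ) 1, s * y + (1 - s) * x ≠ 0 := by
      intro s hs
      rw [Set.uIcc_of_le zero_le_one] at hs
      rcases hs.1.eq_or_lt with rfl | h0
      · simpa using hx.ne'
      · exact (convexCombo_pos hx.le hy ⟨h0, hs.2⟩).ne'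
    have hint : IntervalIntegrable (fun s => s * ((x - y) ^ 2 / (s * y + (1 - s) * x)))
        volume 0 1 :=
      ContinuousOn.intervalIntegrable
        (continuousOn_id.mul (continuousOn_const.div (by fun_prop) hpos))
    refine ⟨hint, ?_⟩
    rw [intervalIntegral.integral_eq_sub_of_hasDerivAt
      (fun s hs => hasDerivAt_mul_sub_mul_log (hpos s hs)) hint]
    simp
    ring

theorem intervalIntegrable_finsetSum {ι : Type*} (t : Finset ι) {f : ι → ℝ → ℝ} {a b : ℝ}
    (h : ∀ i ∈ t, IntervalIntegrable (f i) volume a b) :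
    IntervalIntegrable (fun s => ∑ i ∈ t, f i s) volume a b := by
  simpa only [← Finset.sum_apply] using IntervalIntegrable.sum t h

/-- Completing the square. -/
theorem two_mul_re_sub_le (y x : ℂ) {d : ℝ} (hd : 0 < d) :
    2 * (star y * x).re - d * ‖y‖ ^ 2 ≤ ‖x‖ ^ 2 / d := by
  rw [le_div_iff₀ hd, Complex.sq_norm, Complex.sq_norm, Complex.normSq_apply, Complex.normSq_apply]
  simp only [Complex.star_def, Complex.mul_re, Complex.conj_re, Complex.conj_im]
  nlinarith [sq_nonneg (x.re - d * y.re), sq_nonneg (x.im - d * y.im)]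

theorem two_mul_re_sub_eq (w : ℂ) (x : ℝ) {d : ℝ} (hd : d ≠ 0) :
    2 * (star (((x / d : ℝ) : ℂ) * w) * ((x : ℂ) * w)).re - d * ‖((x / d : ℝ) : ℂ) * w‖ ^ 2 =
      ‖w‖ ^ 2 * (x ^ 2 / d) := by
  rw [norm_mul, mul_pow, Complex.norm_real, Real.norm_eq_abs, sq_abs, star_mul',
    Complex.star_def, Complex.conj_ofReal, mul_mul_mul_comm,
    ← Complex.normSq_eq_conj_mul_self, ← Complex.ofReal_mul, ← Complex.ofReal_mul,
    Complex.ofReal_re, Complex.sq_norm]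
  field_simp
  ring

end Scalar

section Spectral

variable {n : Type*} [Fintype n] [DecidableEq n]

theorem matLog_of_isHermitian {A : Matrix n n ℂ} (hA : A.IsHermitian) :
    matLog A = (hA.eigenvectorUnitary : Matrix n n ℂ) *
      diagonal (fun i => (Real.log (hA.eigenvalues i) : ℂ)) *
      (hA.eigenvectorUnitary : Matrix n n ℂ)ᴴ := by
  rw [matLog, dif_pos hA]

theorem eq_conj_diagonal_eigenvalues {A : Matrix n n ℂ} (hA : A.IsHermitian) :
    A = (hA.eigenvectorUnitary : Matrix n n ℂ) * diagonal (fun i => (hA.eigenvalues i : ℂ)) *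
      (hA.eigenvectorUnitary : Matrix n n ℂ)ᴴ := by
  conv_lhs => rw [hA.spectral_theorem, Unitary.conjStarAlgAut_apply]
  rfl

/-- Trace of a product of two matrices diagonalised by `U` and `V`. -/
theorem trace_conj_diagonal_mul (U V : Matrix n n ℂ) (a b : n → ℝ) :
    ((U * diagonal (fun i => (a i : ℂ)) * Uᴴ) * (V * diagonal (fun i => (b i : ℂ)) * Vᴴ)).trace.re =
      ∑ i, ∑ j, ‖(Uᴴ * V) i j‖ ^ 2 * (a i * b j) := by
  have h : ((U * diagonal (fun i => (a i : ℂ)) * Uᴴ) *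
      (V * diagonal (fun i => (b i : ℂ)) * Vᴴ)).trace =
      ((diagonal (fun i => (a i : ℂ)) * (Uᴴ * V)) * (diagonal (fun i => (b i : ℂ)) *
        (Uᴴ * V)ᴴ)).trace := by
    rw [conjTranspose_mul, conjTranspose_conjTranspose]
    simp only [Matrix.mul_assoc]
    rw [trace_mul_comm]
    simp only [Matrix.mul_assoc]
  rw [h, trace, Complex.re_sum]
  refine Finset.sum_congr rfl fun i _ => ?_
  rw [diag_apply, mul_apply, Complex.re_sum]
  refine Finset.sum_congr rfl fun j _ => ?_
  rw [diagonal_mul, diagonal_mul, conjTranspose_apply, Complex.sq_norm, Complex.normSq_apply]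
  simp
  ring

/-- The quadratic functional whose supremum over `Y` is the integrand of the relative entropy. -/
noncomputable def quadFun (s : ℝ) (P Q Y : Matrix n n ℂ) : ℝ :=
  2 * (Yᴴ * (P - Q)).trace.re - (1 - s) * (Y * Yᴴ * P).trace.re - s * (Yᴴ * Y * Q).trace.re

theorem quadFun_conj {U V : Matrix n n ℂ} (hU : Uᴴ * U = 1) (hV : Vᴴ * V = 1)
    (a b : n → ℝ) (s : ℝ) (y : Matrix n n ℂ) :
    quadFun s (U * diagonal (fun i => (a i : ℂ)) * Uᴴ) (V * diagonal (fun i => (b i : ℂ)) * Vᴴ)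
      (U * y * Vᴴ) =
      ∑ i, ∑ j, (2 * (star (y i j) * (((a i - b j : ℝ) : ℂ) * (Uᴴ * V) i j)).re -
        (s * b j + (1 - s) * a i) * ‖y i j‖ ^ 2) := by
  set Da := diagonal (fun i => (a i : ℂ)) with hDa
  set Db := diagonal (fun i => (b i : ℂ)) with hDb
  have hU' (X : Matrix n n ℂ) : Uᴴ * (U * X) = X := by rw [← Matrix.mul_assoc, hU, Matrix.one_mul]
  have hV' (X : Matrix n n ℂ) : Vᴴ * (V * X) = X := by rw [← Matrix.mul_assoc, hV, Matrix.one_mul]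
  have h₁ : ((U * y * Vᴴ)ᴴ * (U * Da * Uᴴ - V * Db * Vᴴ)).trace =
      ∑ i, ∑ j, star (y i j) * (((a i - b j : ℝ) : ℂ) * (Uᴴ * V) i j) := by
    have : ((U * y * Vᴴ)ᴴ * (U * Da * Uᴴ - V * Db * Vᴴ)).trace =
        (yᴴ * (Da * (Uᴴ * V) - Uᴴ * V * Db)).trace := by
      simp only [conjTranspose_mul, conjTranspose_conjTranspose, Matrix.mul_assoc]
      rw [trace_mul_comm]
      simp only [Matrix.mul_assoc, Matrix.sub_mul, Matrix.mul_sub, hU', hV, Matrix.mul_one]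
    rw [this, trace, Finset.sum_comm]
    refine Finset.sum_congr rfl fun j _ => ?_
    rw [diag_apply, mul_apply]
    refine Finset.sum_congr rfl fun i _ => ?_
    rw [conjTranspose_apply, Matrix.sub_apply, hDa, hDb, diagonal_mul, mul_diagonal]
    push_cast
    ring
  have h₂ : ((U * y * Vᴴ) * (U * y * Vᴴ)ᴴ * (U * Da * Uᴴ)).trace.re =
      ∑ i, ∑ j, a i * ‖y i j‖ ^ 2 := by
    have : ((U * y * Vᴴ) * (U * y * Vᴴ)ᴴ * (U * Da * Uᴴ)).trace = (Da * y * yᴴ).trace := by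
      simp only [conjTranspose_mul, conjTranspose_conjTranspose, Matrix.mul_assoc, hU', hV']
      rw [trace_mul_comm]
      simp only [Matrix.mul_assoc, hU, Matrix.mul_one]
      rw [← Matrix.mul_assoc, trace_mul_comm]
    rw [this, trace, Complex.re_sum]
    refine Finset.sum_congr rfl fun i _ => ?_
    rw [diag_apply, mul_apply, Complex.re_sum]
    refine Finset.sum_congr rfl fun j _ => ?_
    rw [hDa, diagonal_mul, conjTranspose_apply, Complex.sq_norm, Complex.normSq_apply]
    simp
    ring
  have h₃ : ((U * y * Vᴴ)ᴴ * (U * y * Vᴴ) * (V * Db * Vᴴ)).trace.re =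
      ∑ i, ∑ j, b j * ‖y i j‖ ^ 2 := by
    have : ((U * y * Vᴴ)ᴴ * (U * y * Vᴴ) * (V * Db * Vᴴ)).trace = (y * Db * yᴴ).trace := by
      simp only [conjTranspose_mul, conjTranspose_conjTranspose, Matrix.mul_assoc, hU', hV']
      rw [trace_mul_comm]
      simp only [Matrix.mul_assoc, hV, Matrix.mul_one]
      rw [trace_mul_comm, Matrix.mul_assoc]
    rw [this, trace, Complex.re_sum]
    refine Finset.sum_congr rfl fun i _ => ?_
    rw [diag_apply, mul_apply, Complex.re_sum]
    refine Finset.sum_congr rfl fun j _ => ?_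
    rw [hDb, mul_diagonal, conjTranspose_apply, Complex.sq_norm, Complex.normSq_apply]
    simp
    ring
  rw [quadFun, h₁, h₂, h₃]
  simp only [Complex.re_sum, Finset.mul_sum, ← Finset.sum_sub_distrib]
  refine Finset.sum_congr rfl fun i _ => Finset.sum_congr rfl fun j _ => ?_
  ring

/-- The integrand in the integral representation of the relative entropy. -/
noncomputable def relEntDensity {P Q : Matrix n n ℂ} (hP : P.IsHermitian) (hQ : Q.IsHermitian)
    (s : ℝ) : ℝ :=
  ∑ i, ∑ j, ‖((hP.eigenvectorUnitary : Matrix n n ℂ)ᴴ *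
      (hQ.eigenvectorUnitary : Matrix n n ℂ)) i j‖ ^ 2 *
    ((hP.eigenvalues i - hQ.eigenvalues j) ^ 2 /
      (s * hQ.eigenvalues j + (1 - s) * hP.eigenvalues i))

theorem conjTranspose_eigenvectorUnitary_mul {A : Matrix n n ℂ} (hA : A.IsHermitian) :
    (hA.eigenvectorUnitary : Matrix n n ℂ)ᴴ * (hA.eigenvectorUnitary : Matrix n n ℂ) = 1 :=
  Unitary.coe_star_mul_self hA.eigenvectorUnitary

theorem mul_conjTranspose_eigenvectorUnitary {A : Matrix n n ℂ} (hA : A.IsHermitian) :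
    (hA.eigenvectorUnitary : Matrix n n ℂ) * (hA.eigenvectorUnitary : Matrix n n ℂ)ᴴ = 1 :=
  Unitary.coe_mul_star_self hA.eigenvectorUnitary

theorem quadFun_eq_sum {P Q : Matrix n n ℂ} (hP : P.IsHermitian) (hQ : Q.IsHermitian)
    (s : ℝ) (y : Matrix n n ℂ) :
    quadFun s P Q ((hP.eigenvectorUnitary : Matrix n n ℂ) * y *
        (hQ.eigenvectorUnitary : Matrix n n ℂ)ᴴ) =
      ∑ i, ∑ j, (2 * (star (y i j) * (((hP.eigenvalues i - hQ.eigenvalues j : ℝ) : ℂ) *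
        ((hP.eigenvectorUnitary : Matrix n n ℂ)ᴴ *
          (hQ.eigenvectorUnitary : Matrix n n ℂ)) i j)).re -
        (s * hQ.eigenvalues j + (1 - s) * hP.eigenvalues i) * ‖y i j‖ ^ 2) := by
  rw [← quadFun_conj (conjTranspose_eigenvectorUnitary_mul hP)
    (conjTranspose_eigenvectorUnitary_mul hQ), ← eq_conj_diagonal_eigenvalues hP,
    ← eq_conj_diagonal_eigenvalues hQ]

theorem quadFun_le_relEntDensity {P Q : Matrix n n ℂ} (hP : P.PosSemidef) (hQ : Q.PosDef)
    {s : ℝ} (hs : s ∈ Set.Ioc (0 : ℝ) 1) (Y : Matrix n n ℂ) :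
    quadFun s P Q Y ≤ relEntDensity hP.isHermitian hQ.isHermitian s := by
  set U := (hP.isHermitian.eigenvectorUnitary : Matrix n n ℂ) with hU
  set V := (hQ.isHermitian.eigenvectorUnitary : Matrix n n ℂ) with hV
  have hY : Y = U * (Uᴴ * Y * V) * Vᴴ := by
    rw [← Matrix.mul_assoc, ← Matrix.mul_assoc, mul_conjTranspose_eigenvectorUnitary,
      Matrix.one_mul, Matrix.mul_assoc, mul_conjTranspose_eigenvectorUnitary, Matrix.mul_one]
  rw [hY, quadFun_eq_sum, relEntDensity]
  refine Finset.sum_le_sum fun i _ => Finset.sum_le_sum fun j _ => ?_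
  refine (two_mul_re_sub_le _ _
    (convexCombo_pos (hP.eigenvalues_nonneg i) (hQ.eigenvalues_pos j) hs)).trans_eq ?_
  rw [norm_mul, mul_pow, Complex.norm_real, Real.norm_eq_abs, sq_abs]
  ring

theorem exists_quadFun_eq_relEntDensity {P Q : Matrix n n ℂ} (hP : P.PosSemidef) (hQ : Q.PosDef)
    {s : ℝ} (hs : s ∈ Set.Ioc (0 : ℝ) 1) :
    ∃ Y, quadFun s P Q Y = relEntDensity hP.isHermitian hQ.isHermitian s := by
  refine ⟨_, (quadFun_eq_sum hP.isHermitian hQ.isHermitian s (Matrix.of fun i j =>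
    (((hP.isHermitian.eigenvalues i - hQ.isHermitian.eigenvalues j) /
      (s * hQ.isHermitian.eigenvalues j + (1 - s) * hP.isHermitian.eigenvalues i) : ℝ) : ℂ) *
    ((hP.isHermitian.eigenvectorUnitary : Matrix n n ℂ)ᴴ *
      (hQ.isHermitian.eigenvectorUnitary : Matrix n n ℂ)) i j)).trans ?_⟩
  rw [relEntDensity]
  refine Finset.sum_congr rfl fun i _ => Finset.sum_congr rfl fun j _ => ?_
  exact two_mul_re_sub_eq _ _
    (convexCombo_pos (hP.eigenvalues_nonneg i) (hQ.eigenvalues_pos j) hs).ne'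

theorem relEnt_eq_sum {P Q : Matrix n n ℂ} (hP : P.IsHermitian) (hQ : Q.IsHermitian) :
    relEnt P Q - P.trace.re + Q.trace.re =
      ∑ i, ∑ j, ‖((hP.eigenvectorUnitary : Matrix n n ℂ)ᴴ *
        (hQ.eigenvectorUnitary : Matrix n n ℂ)) i j‖ ^ 2 *
        (hP.eigenvalues i * Real.log (hP.eigenvalues i) -
          hP.eigenvalues i * Real.log (hQ.eigenvalues j) -
          hP.eigenvalues i + hQ.eigenvalues j) := by
  set U := (hP.eigenvectorUnitary : Matrix n n ℂ) with hU
  set V := (hQ.eigenvectorUnitary : Matrix n n ℂ) with hV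
  have h1 : ∀ {A : Matrix n n ℂ} (hA : A.IsHermitian), (hA.eigenvectorUnitary : Matrix n n ℂ) *
      diagonal (fun _ => ((1 : ℝ) : ℂ)) * (hA.eigenvectorUnitary : Matrix n n ℂ)ᴴ = 1 := by
    intro A hA
    rw [Complex.ofReal_one, diagonal_one, Matrix.mul_one, mul_conjTranspose_eigenvectorUnitary]
  have hPlogP : (P * matLog P).trace.re = ∑ i, ∑ j, ‖(Uᴴ * V) i j‖ ^ 2 *
      (hP.eigenvalues i * Real.log (hP.eigenvalues i) * 1) := by
    rw [← trace_conj_diagonal_mul U V _ fun _ => 1, h1 hQ, Matrix.mul_one,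
      matLog_of_isHermitian hP]
    conv_lhs => enter [1, 1, 1]; rw [eq_conj_diagonal_eigenvalues hP]
    simp only [Matrix.mul_assoc]
    rw [← Matrix.mul_assoc _ (hP.eigenvectorUnitary : Matrix n n ℂ),
      conjTranspose_eigenvectorUnitary_mul, Matrix.one_mul, ← Matrix.mul_assoc (diagonal _),
      diagonal_mul_diagonal]
    simp only [Complex.ofReal_mul, hU]
  have hPlogQ : (P * matLog Q).trace.re = ∑ i, ∑ j, ‖(Uᴴ * V) i j‖ ^ 2 *
      (hP.eigenvalues i * Real.log (hQ.eigenvalues j)) := by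
    rw [← trace_conj_diagonal_mul, ← eq_conj_diagonal_eigenvalues hP, matLog_of_isHermitian hQ]
  have hPtr : P.trace.re = ∑ i, ∑ j, ‖(Uᴴ * V) i j‖ ^ 2 * (hP.eigenvalues i * 1) := by
    rw [← trace_conj_diagonal_mul U V _ fun _ => 1, ← eq_conj_diagonal_eigenvalues hP, h1 hQ,
      Matrix.mul_one]
  have hQtr : Q.trace.re = ∑ i, ∑ j, ‖(Uᴴ * V) i j‖ ^ 2 * (1 * hQ.eigenvalues j) := by
    rw [← trace_conj_diagonal_mul U V fun _ => 1, ← eq_conj_diagonal_eigenvalues hQ, h1 hP,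
      Matrix.one_mul]
  rw [relEnt, Matrix.mul_sub, trace_sub, Complex.sub_re, hPlogP, hPlogQ, hPtr, hQtr]
  simp only [← Finset.sum_sub_distrib, ← Finset.sum_add_distrib]
  refine Finset.sum_congr rfl fun i _ => Finset.sum_congr rfl fun j _ => ?_
  ring

theorem mul_relEntDensity {P Q : Matrix n n ℂ} (hP : P.IsHermitian) (hQ : Q.IsHermitian) :
    (fun s => s * relEntDensity hP hQ s) = fun s => ∑ i, ∑ j,
      ‖((hP.eigenvectorUnitary : Matrix n n ℂ)ᴴ *
        (hQ.eigenvectorUnitary : Matrix n n ℂ)) i j‖ ^ 2 *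
      (s * ((hP.eigenvalues i - hQ.eigenvalues j) ^ 2 /
        (s * hQ.eigenvalues j + (1 - s) * hP.eigenvalues i))) := by
  funext s
  simp only [relEntDensity, Finset.mul_sum, mul_left_comm s]

theorem intervalIntegrable_relEntDensity {P Q : Matrix n n ℂ} (hP : P.PosSemidef)
    (hQ : Q.PosDef) :
    IntervalIntegrable (fun s => s * relEntDensity hP.isHermitian hQ.isHermitian s)
      volume 0 1 := by
  rw [mul_relEntDensity]
  refine intervalIntegrable_finsetSum _ fun i _ => intervalIntegrable_finsetSum _ fun j _ => ?_
  exact (intervalIntegrable_and_integral_log (hP.eigenvalues_nonneg i)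
    (hQ.eigenvalues_pos j)).1.const_mul _

/-- Integral representation of the relative entropy. -/
theorem integral_relEntDensity {P Q : Matrix n n ℂ} (hP : P.PosSemidef) (hQ : Q.PosDef) :
    ∫ s in (0 : ℝ)..1, s * relEntDensity hP.isHermitian hQ.isHermitian s =
      relEnt P Q - P.trace.re + Q.trace.re := by
  have hint (i j : n) := intervalIntegrable_and_integral_log (hP.eigenvalues_nonneg i)
    (hQ.eigenvalues_pos j)
  rw [mul_relEntDensity, relEnt_eq_sum hP.isHermitian hQ.isHermitian,
    intervalIntegral.integral_finsetSum fun i _ =>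
      intervalIntegrable_finsetSum _ fun j _ => (hint i j).1.const_mul _]
  refine Finset.sum_congr rfl fun i _ => ?_
  rw [intervalIntegral.integral_finsetSum fun j _ => (hint i j).1.const_mul _]
  refine Finset.sum_congr rfl fun j _ => ?_
  rw [intervalIntegral.integral_const_mul, (hint i j).2]

end Spectral

section PartialTrace

variable {A B : Type*} [Fintype B]

theorem ptraceB_eq_sum_submatrix (M : Matrix (A × B) (A × B) ℂ) :
    ptraceB M = ∑ b : B, M.submatrix (fun a => (a, b)) (fun a => (a, b)) := by
  ext a a'
  simp [ptraceB, Matrix.sum_apply]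

theorem Matrix.PosSemidef.ptraceB {M : Matrix (A × B) (A × B) ℂ} (hM : M.PosSemidef) :
    (ptraceB M).PosSemidef := by
  rw [ptraceB_eq_sum_submatrix]
  exact posSemidef_sum _ fun b _ => hM.submatrix _

theorem Matrix.PosDef.ptraceB [Nonempty B] {M : Matrix (A × B) (A × B) ℂ} (hM : M.PosDef) :
    (ptraceB M).PosDef := by
  rw [ptraceB_eq_sum_submatrix]
  exact posDef_sum Finset.univ_nonempty fun b _ => hM.submatrix (Prod.mk_left_injective b)

theorem ptraceB_sub (M N : Matrix (A × B) (A × B) ℂ) :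
    ptraceB (M - N) = ptraceB M - ptraceB N := by
  ext a a'
  simp [ptraceB]

variable [Fintype A]

theorem trace_ptraceB (M : Matrix (A × B) (A × B) ℂ) : (ptraceB M).trace = M.trace := by
  simp [trace, ptraceB, Fintype.sum_prod_type]

variable [DecidableEq B]

theorem trace_kronecker_one_mul (Z : Matrix A A ℂ) (M : Matrix (A × B) (A × B) ℂ) :
    ((Z ⊗ₖ (1 : Matrix B B ℂ)) * M).trace = (Z * ptraceB M).trace := by
  simp only [trace, diag_apply, mul_apply, ptraceB, of_apply, Fintype.sum_prod_type,
    kroneckerMap_apply, one_apply, mul_ite, mul_one, mul_zero, ite_mul, zero_mul,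
    Finset.sum_ite_eq, Finset.mem_univ, if_true, Finset.mul_sum]
  exact Finset.sum_congr rfl fun a _ => Finset.sum_comm

theorem quadFun_ptraceB (s : ℝ) (P Q : Matrix (A × B) (A × B) ℂ) (Y : Matrix A A ℂ) :
    quadFun s (ptraceB P) (ptraceB Q) Y = quadFun s P Q (Y ⊗ₖ (1 : Matrix B B ℂ)) := by
  simp only [quadFun, conjTranspose_kronecker, conjTranspose_one, ← mul_kronecker_mul,
    Matrix.one_mul, trace_kronecker_one_mul, ptraceB_sub]

variable [DecidableEq A] [Nonempty B]

theorem relEntDensity_ptraceB_le {P Q : Matrix (A × B) (A × B) ℂ} (hP : P.PosSemidef)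
    (hQ : Q.PosDef) {s : ℝ} (hs : s ∈ Set.Ioc (0 : ℝ) 1) :
    relEntDensity hP.ptraceB.isHermitian hQ.ptraceB.isHermitian s ≤
      relEntDensity hP.isHermitian hQ.isHermitian s := by
  obtain ⟨Y, hY⟩ := exists_quadFun_eq_relEntDensity hP.ptraceB hQ.ptraceB hs
  rw [← hY, quadFun_ptraceB]
  exact quadFun_le_relEntDensity hP hQ hs _

theorem relEnt_ptraceB_le_of_nonempty {P Q : Matrix (A × B) (A × B) ℂ} (hP : P.PosSemidef)
    (hQ : Q.PosDef) : relEnt (ptraceB P) (ptraceB Q) ≤ relEnt P Q := by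
  have h : ∫ s in (0 : ℝ)..1, s * relEntDensity hP.ptraceB.isHermitian hQ.ptraceB.isHermitian s ≤
      ∫ s in (0 : ℝ)..1, s * relEntDensity hP.isHermitian hQ.isHermitian s := by
    refine intervalIntegral.integral_mono_on zero_le_one
      (intervalIntegrable_relEntDensity hP.ptraceB hQ.ptraceB)
      (intervalIntegrable_relEntDensity hP hQ) fun s hs => ?_
    rcases hs.1.eq_or_lt with rfl | h0
    · simp
    · exact mul_le_mul_of_nonneg_left (relEntDensity_ptraceB_le hP hQ ⟨h0, hs.2⟩) h0.le
  rw [integral_relEntDensity hP.ptraceB hQ.ptraceB, integral_relEntDensity hP hQ,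
    trace_ptraceB, trace_ptraceB] at h
  linarith

end PartialTrace

/-- Monotonicity of relative entropy under the partial trace. -/
theorem relEnt_ptrace_le {dA dB : ℕ}
    (ρ γ : Matrix (Fin dA × Fin dB) (Fin dA × Fin dB) ℂ)
    (hρ : ρ.PosSemidef) (hγ : γ.PosDef) :
    relEnt (ptraceB ρ) (ptraceB γ) ≤ relEnt ρ γ := by
  rcases isEmpty_or_nonempty (Fin dB) with hB | hB
  · have h : ptraceB ρ = 0 := by
      ext a a'
      simp [ptraceB]
    simp [relEnt, h, trace]
  · exact relEnt_ptraceB_le_of_nonempty hρ hγ
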